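/- arXiv:1907.10271 — 2 statements merged into one kernel-verified Lean document; each statement's English description precedes it below -/
import Mathlib

section
/- Let L be a natural number, e_s > 0, and for ℓ = 0, …, L let V_ℓ > 0 and C_ℓ > 0 be real numbers. Then for any positive real numbers N_0, …, N_L satisfying the sampling-error constraint ∑_{ℓ=0}^{L} V_ℓ/N_ℓ ≤ e_s², the total cost satisfies ∑_{ℓ=0}^{L} N_ℓ C_ℓ ≥ e_s^{−2} (∑_{ℓ=0}^{L} √(V_ℓ C_ℓ))². -/
/-- Lower bound on the multilevel Monte Carlo cost: any (real-valued) sample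
allocation `N_ℓ` satisfying the sampling-error constraint `∑ V_ℓ/N_ℓ ≤ e_s²`
has total cost at least `e_s⁻² (∑ √(V_ℓ C_ℓ))²`. -/
theorem mlmc_cost_lower_bound (L : ℕ) (es : ℝ) (hes : 0 < es)
    (V C N : Fin (L + 1) → ℝ)
    (hV : ∀ ℓ, 0 < V ℓ) (hC : ∀ ℓ, 0 < C ℓ) (hN : ∀ ℓ, 0 < N ℓ)
    (hconstraint : ∑ ℓ, V ℓ / N ℓ ≤ es ^ 2) :
    (∑ ℓ, Real.sqrt (V ℓ * C ℓ)) ^ 2 / es ^ 2 ≤ ∑ ℓ, N ℓ * C ℓ := by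
  have hNC : ∀ ℓ ∈ Finset.univ, 0 ≤ N ℓ * C ℓ := fun ℓ _ ↦ (mul_pos (hN ℓ) (hC ℓ)).le
  rw [div_le_iff₀ (pow_pos hes 2)]
  calc (∑ ℓ, Real.sqrt (V ℓ * C ℓ)) ^ 2
      ≤ (∑ ℓ, N ℓ * C ℓ) * ∑ ℓ, V ℓ / N ℓ := by
        refine Finset.sum_sq_le_sum_mul_sum_of_sq_le_mul _ hNC
          (fun ℓ _ ↦ (div_pos (hV ℓ) (hN ℓ)).le) fun ℓ _ ↦ le_of_eq ?_
        rw [Real.sq_sqrt (mul_pos (hV ℓ) (hC ℓ)).le]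
        have := (hN ℓ).ne'
        field_simp
    _ ≤ (∑ ℓ, N ℓ * C ℓ) * es ^ 2 :=
        mul_le_mul_of_nonneg_left hconstraint (Finset.sum_nonneg hNC)
end

section
/- Let α > 0, 0 < β < γ, m > 1, M₀ > 0, C₁ > 0, c₂ > 0, c₄ > 0 be real numbers, and set M_ℓ = m^ℓ M₀. Suppose for every ℓ, V_ℓ ≤ c₄ M_ℓ^{−β} and C_ℓ ≤ c₂ M_ℓ^{γ} with V_ℓ, C_ℓ ≥ 0. Then there exists a constant C > 0, depending only on α, β, γ, m, M₀, C₁, c₂, c₄, such that for every e with 0 < e ≤ √2 · C₁ · M₀^{−α}, if L is the smallest natural number with C₁ (m^L M₀)^{−α} ≤ e/√2, then the optimal multilevel cost satisfies (e²/2)^{−1} (∑_{ℓ=0}^{L} √(V_ℓ C_ℓ))² ≤ C · e^{−2−(γ−β)/α}. -/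
/-- If a power-law bias `a x^(-α)` is at least `e`, then `x ≤ (a / e)^(1/α)`. -/
theorem le_rpow_of_le_mul_rpow_neg {α a e x : ℝ} (hα : 0 < α) (he : 0 < e) (hx : 0 < x)
    (h : e ≤ a * x ^ (-α)) : x ≤ (a / e) ^ (1 / α) := by
  have hxα : 0 < x ^ α := Real.rpow_pos_of_pos hx α
  rw [Real.rpow_neg hx.le, ← div_eq_mul_inv, le_div_iff₀ hxα] at h
  have h1 : x ^ α ≤ a / e := by
    rw [le_div_iff₀ he]
    linarith
  calc x = (x ^ α) ^ (1 / α) := by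
        rw [← Real.rpow_mul hx.le, mul_one_div_cancel hα.ne', Real.rpow_one]
    _ ≤ (a / e) ^ (1 / α) := Real.rpow_le_rpow hxα.le h1 (by positivity)

/-- A geometric sequence of ratio `q > 1` has partial sums dominated by their last term. -/
theorem sum_range_succ_le_of_geometric {q : ℝ} (hq : 1 < q) {f : ℕ → ℝ} (h0 : 0 ≤ f 0)
    (hf : ∀ n, f (n + 1) = q * f n) (L : ℕ) :
    ∑ n ∈ Finset.range (L + 1), f n ≤ q / (q - 1) * f L := by
  have hq' : 0 < q - 1 := sub_pos.mpr hq
  induction L with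
  | zero =>
    have h1 : 1 ≤ q / (q - 1) := by
      rw [le_div_iff₀ hq']
      linarith
    simpa using le_mul_of_one_le_left h0 h1
  | succ L ih =>
    rw [Finset.sum_range_succ]
    calc _ ≤ q / (q - 1) * f L + f (L + 1) := by gcongr
      _ = q / (q - 1) * f (L + 1) := by
        rw [hf]
        field_simp
        ring

/-- The work-variance product at one level, with mesh parameter `x`. -/
theorem sqrt_mul_le_of_rpow_bounds {β γ c₂ c₄ v c x : ℝ} (hx : 0 < x) (hc₂ : 0 ≤ c₂)
    (hc₄ : 0 ≤ c₄) (hc : 0 ≤ c) (hv' : v ≤ c₄ * x ^ (-β)) (hc' : c ≤ c₂ * x ^ γ) :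
    Real.sqrt (v * c) ≤ Real.sqrt (c₂ * c₄) * x ^ ((γ - β) / 2) := by
  rw [Real.sqrt_le_iff]
  refine ⟨by positivity, ?_⟩
  calc v * c ≤ (c₄ * x ^ (-β)) * (c₂ * x ^ γ) :=
        mul_le_mul hv' hc' hc (by positivity)
    _ = c₂ * c₄ * x ^ (γ - β) := by
        rw [show γ - β = -β + γ by ring, Real.rpow_add hx]
        ring
    _ = (Real.sqrt (c₂ * c₄) * x ^ ((γ - β) / 2)) ^ 2 := by
        rw [mul_pow, Real.sq_sqrt (by positivity), ← Real.rpow_mul_natCast hx.le]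
        norm_num

/-- MLMC complexity in the regime `β < γ`: with the finest level `L` chosen as
the smallest level for which the bias bound `C₁ M_L^(−α)` is below `e/√2`, the
optimal multilevel cost `(e²/2)⁻¹ (∑_ℓ √(V_ℓ C_ℓ))²` is bounded by a constant
(depending only on `α, β, γ, m, M₀, C₁, c₂, c₄`) times `e^(−2−(γ−β)/α)`. -/
theorem mlmc_complexity (α β γ m M₀ C₁ c₂ c₄ : ℝ)
    (hα : 0 < α) (hβ : 0 < β) (hβγ : β < γ) (hm : 1 < m) (hM₀ : 0 < M₀)
    (hC₁ : 0 < C₁) (hc₂ : 0 < c₂) (hc₄ : 0 < c₄) :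
    ∃ C : ℝ, 0 < C ∧
      ∀ (V Cl : ℕ → ℝ), (∀ ℓ, 0 ≤ V ℓ) → (∀ ℓ, 0 ≤ Cl ℓ) →
        (∀ ℓ : ℕ, V ℓ ≤ c₄ * (m ^ ℓ * M₀) ^ (-β)) →
        (∀ ℓ : ℕ, Cl ℓ ≤ c₂ * (m ^ ℓ * M₀) ^ γ) →
        ∀ e : ℝ, 0 < e → e ≤ Real.sqrt 2 * C₁ * M₀ ^ (-α) →
          ∀ L : ℕ, C₁ * (m ^ L * M₀) ^ (-α) ≤ e / Real.sqrt 2 →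
            (∀ L' : ℕ, L' < L → ¬ C₁ * (m ^ L' * M₀) ^ (-α) ≤ e / Real.sqrt 2) →
            (e ^ 2 / 2)⁻¹ * (∑ ℓ ∈ Finset.range (L + 1), Real.sqrt (V ℓ * Cl ℓ)) ^ 2 ≤
              C * e ^ (-2 - (γ - β) / α) := by
  have hm0 : 0 < m := by linarith
  have hδ : 0 < γ - β := sub_pos.mpr hβγ
  have hq : 1 < m ^ ((γ - β) / 2) := Real.one_lt_rpow hm (by positivity)
  set q := m ^ ((γ - β) / 2)
  have hq' : 0 < q - 1 := sub_pos.mpr hq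
  have h2 : 0 < Real.sqrt 2 := by positivity
  refine ⟨2 * (Real.sqrt (c₂ * c₄) * (q / (q - 1))) ^ 2 *
    (m ^ (γ - β) * (Real.sqrt 2 * C₁) ^ ((γ - β) / α)), by positivity, ?_⟩
  intro V Cl _ hCl hVb hClb e he he0 L _ hLmin
  have hM : ∀ ℓ : ℕ, 0 < m ^ ℓ * M₀ := fun ℓ => by positivity
  have hsum : ∑ ℓ ∈ Finset.range (L + 1), Real.sqrt (V ℓ * Cl ℓ) ≤
      Real.sqrt (c₂ * c₄) * (q / (q - 1)) * (m ^ L * M₀) ^ ((γ - β) / 2) := by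
    calc _ ≤ ∑ ℓ ∈ Finset.range (L + 1),
          Real.sqrt (c₂ * c₄) * (m ^ ℓ * M₀) ^ ((γ - β) / 2) :=
          Finset.sum_le_sum fun ℓ _ => sqrt_mul_le_of_rpow_bounds (hM ℓ) hc₂.le hc₄.le
            (hCl ℓ) (hVb ℓ) (hClb ℓ)
      _ ≤ _ := by
          rw [← Finset.mul_sum, mul_assoc]
          refine mul_le_mul_of_nonneg_left ?_ (by positivity)
          refine sum_range_succ_le_of_geometric hq
            (f := fun ℓ => (m ^ ℓ * M₀) ^ ((γ - β) / 2)) (by positivity) (fun n => ?_) L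
          rw [pow_succ', mul_assoc, Real.mul_rpow hm0.le (hM n).le]
  have hmesh : m ^ L * M₀ ≤ m * (Real.sqrt 2 * C₁ / e) ^ (1 / α) := by
    cases L with
    | zero =>
      have h := le_rpow_of_le_mul_rpow_neg hα he hM₀ he0
      rw [pow_zero, one_mul]
      exact h.trans (le_mul_of_one_le_left (by positivity) hm.le)
    | succ L =>
      have h := not_le.mp (hLmin L (Nat.lt_succ_self L))
      rw [div_lt_iff₀ h2] at h
      rw [pow_succ', mul_assoc]
      refine mul_le_mul_of_nonneg_left ?_ hm0.le
      exact le_rpow_of_le_mul_rpow_neg hα he (hM L) (by linarith)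
  have hmeshδ : (m ^ L * M₀) ^ (γ - β) ≤
      m ^ (γ - β) * (Real.sqrt 2 * C₁) ^ ((γ - β) / α) * e ^ (-((γ - β) / α)) := by
    calc _ ≤ (m * (Real.sqrt 2 * C₁ / e) ^ (1 / α)) ^ (γ - β) :=
          Real.rpow_le_rpow (hM L).le hmesh hδ.le
      _ = _ := by
          rw [Real.mul_rpow hm0.le (by positivity), ← Real.rpow_mul (by positivity),
            one_div_mul_eq_div, Real.div_rpow (by positivity) he.le, Real.rpow_neg he.le,
            div_eq_mul_inv, mul_assoc]
  have hsq : ((m ^ L * M₀) ^ ((γ - β) / 2)) ^ 2 = (m ^ L * M₀) ^ (γ - β) := by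
    rw [← Real.rpow_mul_natCast (hM L).le]
    norm_num
  have hesplit : e ^ (-2 - (γ - β) / α) = (e ^ 2)⁻¹ * e ^ (-((γ - β) / α)) := by
    rw [sub_eq_add_neg, Real.rpow_add he, Real.rpow_neg he.le, Real.rpow_two]
  calc _ ≤ (e ^ 2 / 2)⁻¹ * (Real.sqrt (c₂ * c₄) * (q / (q - 1)) *
        (m ^ L * M₀) ^ ((γ - β) / 2)) ^ 2 := by gcongr
    _ = 2 * (e ^ 2)⁻¹ * (Real.sqrt (c₂ * c₄) * (q / (q - 1))) ^ 2 *
        (m ^ L * M₀) ^ (γ - β) := by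
        rw [mul_pow _ ((m ^ L * M₀) ^ ((γ - β) / 2)), hsq, inv_div, div_eq_mul_inv]
        ring
    _ ≤ 2 * (e ^ 2)⁻¹ * (Real.sqrt (c₂ * c₄) * (q / (q - 1))) ^ 2 *
        (m ^ (γ - β) * (Real.sqrt 2 * C₁) ^ ((γ - β) / α) * e ^ (-((γ - β) / α))) :=
        mul_le_mul_of_nonneg_left hmeshδ (by positivity)
    _ = _ := by
        rw [hesplit]
        ring
end
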